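/- If u : D → [-∞, +∞) is K-quasinearly subharmonic n.s. for some K ≥ 1, then either u ≡ -∞ on D, or u is finite almost everywhere in D and u ∈ L¹_loc(D). -/

import Mathlib

open MeasureTheory Metric Filter Set ENNReal

noncomputable section

/-- The positive part of an extended real number, as an element of `ℝ≥0∞`. -/
def erealPos (x : EReal) : ℝ≥0∞ := if x = ⊤ then ⊤ else ENNReal.ofReal x.toReal

/-- `ν_n`, the Lebesgue measure of the unit ball of `ℝⁿ`. -/
def nuBall (n : ℕ) : ℝ := (volume (Metric.ball (0 : EuclideanSpace ℝ (Fin n)) 1)).toReal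

/-- The (upper) integral `∫_A u dm_n` of an `EReal`-valued function, defined as the
lintegral of the positive part minus the lintegral of the negative part (an `EReal`). -/
def erealIntegralOn {n : ℕ} (A : Set (EuclideanSpace ℝ (Fin n)))
    (u : EuclideanSpace ℝ (Fin n) → EReal) : EReal :=
  ((∫⁻ y in A, erealPos (u y) : ℝ≥0∞) : EReal) - ((∫⁻ y in A, erealPos (-(u y)) : ℝ≥0∞) : EReal)

/-- `u⁺ ∈ L¹_loc(D)`: the positive part of `u` has finite integral over every
compact subset of `D`. -/
def PosPartLocInt {n : ℕ} (u : EuclideanSpace ℝ (Fin n) → EReal)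
    (D : Set (EuclideanSpace ℝ (Fin n))) : Prop :=
  ∀ E ⊆ D, IsCompact E → ∫⁻ x in E, erealPos (u x) < ⊤

/-- `u : D → [-∞, +∞)` is subharmonic on `D`: upper semicontinuous on `D`, never `+∞` on `D`,
and satisfying the sub-mean-value inequality on every closed ball contained in `D`.
(The function `≡ -∞` satisfies this definition.) -/
def SubharmonicOn {n : ℕ} (u : EuclideanSpace ℝ (Fin n) → EReal)
    (D : Set (EuclideanSpace ℝ (Fin n))) : Prop :=
  UpperSemicontinuousOn u D ∧ (∀ x ∈ D, u x < ⊤) ∧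
  ∀ x r, 0 < r → closedBall x r ⊆ D →
    u x ≤ ((1 / (nuBall n * r ^ n) : ℝ) : EReal) * erealIntegralOn (ball x r) u

/-- `u : D → [-∞, +∞)` is nearly subharmonic on `D`. -/
def NearlySubharmonicOn {n : ℕ} (u : EuclideanSpace ℝ (Fin n) → EReal)
    (D : Set (EuclideanSpace ℝ (Fin n))) : Prop :=
  Measurable (D.restrict u) ∧ (∀ x ∈ D, u x < ⊤) ∧ PosPartLocInt u D ∧
  ∀ x r, 0 < r → closedBall x r ⊆ D →
    u x ≤ ((1 / (nuBall n * r ^ n) : ℝ) : EReal) * erealIntegralOn (ball x r) u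

/-- `u : D → [-∞, +∞)` is `K`-quasinearly subharmonic on `D`:
Lebesgue measurable, `u⁺ ∈ L¹_loc(D)`, and for every `M ≥ 0` the function
`u_M := max {u, -M} + M` satisfies the generalized sub-mean-value inequality with constant `K`
on every closed ball contained in `D`. -/
def QNSubharmonicOn {n : ℕ} (K : ℝ) (u : EuclideanSpace ℝ (Fin n) → EReal)
    (D : Set (EuclideanSpace ℝ (Fin n))) : Prop :=
  Measurable (D.restrict u) ∧ (∀ x ∈ D, u x < ⊤) ∧ PosPartLocInt u D ∧
  ∀ M : ℝ, 0 ≤ M → ∀ x r, 0 < r → closedBall x r ⊆ D →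
    erealPos ((u x ⊔ ((-M : ℝ) : EReal)) + ((M : ℝ) : EReal)) ≤
      ENNReal.ofReal (K / (nuBall n * r ^ n)) *
        ∫⁻ y in ball x r, erealPos ((u y ⊔ ((-M : ℝ) : EReal)) + ((M : ℝ) : EReal))

/-- `u : D → [-∞, +∞)` is `K`-quasinearly subharmonic n.s. (in the narrow sense) on `D`. -/
def QNSubharmonicNSOn {n : ℕ} (K : ℝ) (u : EuclideanSpace ℝ (Fin n) → EReal)
    (D : Set (EuclideanSpace ℝ (Fin n))) : Prop :=
  Measurable (D.restrict u) ∧ (∀ x ∈ D, u x < ⊤) ∧ PosPartLocInt u D ∧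
  ∀ x r, 0 < r → closedBall x r ⊆ D →
    u x ≤ ((K / (nuBall n * r ^ n) : ℝ) : EReal) * erealIntegralOn (ball x r) u

/-- `log⁺` on `[0, +∞]`. -/
def logPlusE (t : ℝ≥0∞) : ℝ≥0∞ := if t = ⊤ then ⊤ else ENNReal.ofReal (Real.log t.toReal)

theorem measurable_erealPos : Measurable erealPos :=
  Measurable.ite (measurableSet_singleton ⊤) measurable_const
    (ENNReal.measurable_ofReal.comp measurable_ereal_toReal)

theorem nuBall_pos (n : ℕ) : 0 < nuBall n :=
  ENNReal.toReal_pos (measure_ball_pos volume _ one_pos).ne' measure_ball_lt_top.ne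

theorem erealIntegralOn_eq_bot {n : ℕ} {A : Set (EuclideanSpace ℝ (Fin n))}
    {u : EuclideanSpace ℝ (Fin n) → EReal} (h : ∫⁻ y in A, erealPos (-(u y)) = ⊤) :
    erealIntegralOn A u = ⊥ := by
  simp [erealIntegralOn, h]

/-- The negative part of a quasinearly subharmonic function n.s. is integrable over every ball
centred at a point where the function is finite. -/
theorem QNSubharmonicNSOn.lintegral_neg_ball_lt_top {n : ℕ} {K : ℝ}
    {D : Set (EuclideanSpace ℝ (Fin n))} {u : EuclideanSpace ℝ (Fin n) → EReal}
    (h : QNSubharmonicNSOn K u D) (hK : 0 < K) {z : EuclideanSpace ℝ (Fin n)} {r : ℝ}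
    (hr : 0 < r) (hzr : closedBall z r ⊆ D) (hz : u z ≠ ⊥) :
    ∫⁻ y in ball z r, erealPos (-(u y)) < ⊤ := by
  by_contra! hb
  have hc : 0 < K / (nuBall n * r ^ n) := div_pos hK (mul_pos (nuBall_pos n) (pow_pos hr n))
  have hle := h.2.2.2 z r hr hzr
  rw [erealIntegralOn_eq_bot (top_le_iff.mp hb), EReal.coe_mul_bot_of_pos hc] at hle
  exact hz (le_bot_iff.mp hle)

theorem ae_ne_bot_of_lintegral_neg_lt_top {n : ℕ} {D A : Set (EuclideanSpace ℝ (Fin n))}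
    {u : EuclideanSpace ℝ (Fin n) → EReal} (hD : MeasurableSet D)
    (hu : Measurable (D.domRestrict u)) (hA : A ⊆ D)
    (h : ∫⁻ y in A, erealPos (-(u y)) < ⊤) :
    ∀ᵐ x ∂(volume.restrict A), u x ≠ ⊥ := by
  have hm : AEMeasurable u (volume.restrict A) :=
    ((aemeasurable_restrict_iff_comap_subtype hD).mpr hu.aemeasurable).mono_measure
      (Measure.restrict_mono hA le_rfl)
  have hf : AEMeasurable (fun x => erealPos (-(u x))) (volume.restrict A) :=
    measurable_erealPos.comp_aemeasurable (measurable_neg.comp_aemeasurable hm)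
  filter_upwards [ae_lt_top' hf h.ne] with x hx hbot
  simp [erealPos, hbot] at hx

theorem qns_ns_bot_or_locally_integrable
    (n : ℕ) (hn : 2 ≤ n)
    (D : Set (EuclideanSpace ℝ (Fin n))) (hDopen : IsOpen D) (hDconn : IsConnected D)
    (K : ℝ) (hK : 1 ≤ K) (u : EuclideanSpace ℝ (Fin n) → EReal)
    (h : QNSubharmonicNSOn K u D) :
    (∀ x ∈ D, u x = ⊥) ∨
    ((∀ᵐ x ∂(volume.restrict D), u x ≠ ⊥) ∧
      PosPartLocInt u D ∧ PosPartLocInt (fun x => -(u x)) D) := by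
  have hK0 : 0 < K := one_pos.trans_le hK
  by_cases hbot : ∀ x ∈ D, u x = ⊥
  · exact Or.inl hbot
  push Not at hbot
  obtain ⟨x₀, hx₀, hux₀⟩ := hbot
  let G : Set (EuclideanSpace ℝ (Fin n)) :=
    {x | ∃ U, IsOpen U ∧ x ∈ U ∧ U ⊆ D ∧ ∫⁻ y in U, erealPos (-(u y)) < ⊤}
  have hGopen : IsOpen G := by
    refine isOpen_iff_forall_mem_open.mpr fun x ⟨U, hU, hxU, hUD, hint⟩ => ?_
    exact ⟨U, fun y hy => ⟨U, hU, hy, hUD, hint⟩, hU, hxU⟩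
  have hball : ∀ z r, 0 < r → closedBall z r ⊆ D → u z ≠ ⊥ → ball z r ⊆ G :=
    fun z r hr hzr hz y hy => ⟨ball z r, isOpen_ball, hy, ball_subset_closedBall.trans hzr,
      h.lintegral_neg_ball_lt_top hK0 hr hzr hz⟩
  have hGne : (D ∩ G).Nonempty := by
    obtain ⟨r, hr, hrD⟩ := nhds_basis_closedBall.mem_iff.mp (hDopen.mem_nhds hx₀)
    exact ⟨x₀, hx₀, hball x₀ r hr hrD hux₀ (mem_ball_self hr)⟩
  have hGclosed : closure G ∩ D ⊆ G := by
    rintro x ⟨hxG, hxD⟩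
    obtain ⟨r, hr, hrD⟩ := nhds_basis_closedBall.mem_iff.mp (hDopen.mem_nhds hxD)
    obtain ⟨y, ⟨U, hU, hyU, hUD, hint⟩, hxy⟩ := Metric.mem_closure_iff.mp hxG (r / 2) (half_pos hr)
    have hVopen : IsOpen (U ∩ ball x (r / 2)) := hU.inter isOpen_ball
    have hae := ae_ne_bot_of_lintegral_neg_lt_top hDopen.measurableSet h.1
      (inter_subset_left.trans hUD)
      ((lintegral_mono_set (inter_subset_left (t := ball x (r / 2)))).trans_lt hint)
    have : (ae (volume.restrict (U ∩ ball x (r / 2)))).NeBot :=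
      ae_restrict_neBot.mpr (hVopen.measure_pos volume ⟨y, hyU, mem_ball'.mpr hxy⟩).ne'
    obtain ⟨z, ⟨-, hzx⟩, hz⟩ := ((ae_restrict_mem hVopen.measurableSet).and hae).exists
    refine hball z (r / 2) (half_pos hr) ?_ hz (mem_ball'.mpr hzx)
    refine (closedBall_subset_closedBall' ?_).trans hrD
    linarith [mem_ball.mp hzx]
  have hDG : D ⊆ G :=
    hDconn.isPreconnected.subset_of_closure_inter_subset hGopen hGne hGclosed
  refine Or.inr ⟨?_, h.2.2.1, fun E hED hE => ?_⟩
  · rw [ae_restrict_iff' hDopen.measurableSet]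
    change volume {x | ¬(x ∈ D → u x ≠ ⊥)} = 0
    refine measure_null_of_locally_null _ fun x hx => ?_
    obtain ⟨U, hU, hxU, hUD, hint⟩ := hDG (by by_contra hxD; exact hx fun h => absurd h hxD)
    have hae := ae_ne_bot_of_lintegral_neg_lt_top hDopen.measurableSet h.1 hUD hint
    rw [ae_restrict_iff' hU.measurableSet] at hae
    refine ⟨_, inter_mem_nhdsWithin _ (hU.mem_nhds hxU), measure_mono_null ?_ hae⟩
    exact fun y hy hy' => hy.1 fun _ => hy' hy.2
  · refine hE.induction_on (p := fun s => ∫⁻ x in s, erealPos (-(u x)) < ⊤) (by simp)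
      (fun s t hst ht => (lintegral_mono_set hst).trans_lt ht)
      (fun s t hs ht => (lintegral_union_le _ s t).trans_lt (ENNReal.add_lt_top.mpr ⟨hs, ht⟩))
      fun x hx => ?_
    obtain ⟨U, hU, hxU, -, hint⟩ := hDG (hED hx)
    exact ⟨U, mem_nhdsWithin_of_mem_nhds (hU.mem_nhds hxU), hint⟩
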